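/- Let A be an n×n real matrix with spectralRadius(A) < 1 (viewing A as a complex matrix), B an n×q real matrix, C a p×n real matrix, and D a p×q real matrix. Define G^[0] := D and G^[i] := C·A^{i−1}·B for i ≥ 1; then Σ_{i≥0} ‖G^[i]‖_op < ∞, and for every sequence u : ℕ → ℝ^q with Σ_{n≥0} ‖u_n‖₂² = 1 (the series being summable with sum 1), the series Σ_{n=0}^∞ ‖(G∗u)(n)‖₂² converges and its sum is at least ⨅_{z ∈ ℂ, |z|=1} σ_min(D + C·(z·I − A)^{−1}·B)², where D, C, A, B are viewed as complex matrices. -/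

import Mathlib

/-- The ℓ²→ℓ² operator norm of a matrix. -/
noncomputable def opNorm {𝕜 : Type*} [RCLike 𝕜] {m n : Type*} [Fintype m] [Fintype n]
    [DecidableEq n] (M : Matrix m n 𝕜) : ℝ :=
  ‖LinearMap.toContinuousLinearMap (Matrix.toEuclideanLin M)‖

/-- The minimal singular value `σ_min(M)`: the infimum of `‖M v‖₂` over unit vectors `v`. -/
noncomputable def sigmaMin {𝕜 : Type*} [RCLike 𝕜] {m n : Type*} [Fintype m] [Fintype n]
    [DecidableEq n] (M : Matrix m n 𝕜) : ℝ :=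
  ⨅ v : {v : EuclideanSpace 𝕜 n // ‖v‖ = 1}, ‖Matrix.toEuclideanLin M v.1‖

/-- The convolution `(G ∗ u)(k) = Σ_{i=0}^{k} G^[i] u_{k−i}` of a matrix sequence with a
vector sequence. -/
noncomputable def conv {𝕜 : Type*} [RCLike 𝕜] {m n : Type*} [Fintype m] [Fintype n]
    [DecidableEq n] (G : ℕ → Matrix m n 𝕜) (u : ℕ → EuclideanSpace 𝕜 n) (k : ℕ) :
    EuclideanSpace 𝕜 m :=
  ∑ i ∈ Finset.range (k + 1), Matrix.toEuclideanLin (G i) (u (k - i))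

open Filter Topology Finset in
/-- In a complex Banach algebra, the powers of an element of spectral radius less than `1` are
absolutely summable. -/
theorem summable_norm_pow_of_spectralRadius_lt_one {R : Type*} [NormedRing R] [NormedAlgebra ℂ R]
    [CompleteSpace R] (a : R) (ha : spectralRadius ℂ a < 1) : Summable fun i : ℕ => ‖a ^ i‖ := by
  obtain ⟨r, har, hr1⟩ := ENNReal.lt_iff_exists_nnreal_btwn.1 ha
  have hr1' : (r : ℝ) < 1 := by exact_mod_cast hr1
  have hev := (spectrum.pow_nnnorm_pow_one_div_tendsto_nhds_spectralRadius a).eventually_lt_const har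
  refine Summable.of_norm_bounded_eventually_nat
    (summable_geometric_of_lt_one r.coe_nonneg hr1') ?_
  filter_upwards [hev, eventually_gt_atTop 0] with i hi hi0
  rw [norm_norm]
  have hi0' : (i : ℝ) ≠ 0 := by positivity
  have h := ENNReal.rpow_le_rpow hi.le (Nat.cast_nonneg (α := ℝ) i)
  rw [← ENNReal.rpow_mul, one_div_mul_cancel hi0', ENNReal.rpow_one, ENNReal.rpow_natCast] at h
  exact_mod_cast h

/-- **Young's inequality** for the convolution of a summable and a square-summable sequence. -/
theorem summable_and_tsum_sq_sum_range_mul_le {g a : ℕ → ℝ} (hg0 : ∀ i, 0 ≤ g i)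
    (hg : Summable g) (ha : Summable fun k => a k ^ 2) :
    Summable (fun k => (∑ i ∈ Finset.range (k + 1), g i * a (k - i)) ^ 2) ∧
      ∑' k, (∑ i ∈ Finset.range (k + 1), g i * a (k - i)) ^ 2 ≤
        (∑' i, g i) ^ 2 * ∑' k, a k ^ 2 := by
  have hgn : Summable fun i => ‖g i‖ := hg.norm
  have han : Summable fun k => ‖a k ^ 2‖ := ha.norm
  have hsum := hasSum_sum_range_mul_of_summable_norm hgn han
  have hle : ∀ k, (∑ i ∈ Finset.range (k + 1), g i * a (k - i)) ^ 2 ≤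
      (∑' i, g i) * ∑ i ∈ Finset.range (k + 1), g i * a (k - i) ^ 2 := by
    intro k
    have hcs := Finset.sum_sq_le_sum_mul_sum_of_sq_le_mul (Finset.range (k + 1))
      (r := fun i => g i * a (k - i)) (f := g) (g := fun i => g i * a (k - i) ^ 2)
      (fun i _ => hg0 i) (fun i _ => mul_nonneg (hg0 i) (sq_nonneg _))
      (fun i _ => le_of_eq (by ring))
    refine hcs.trans (mul_le_mul_of_nonneg_right (hg.sum_le_tsum _ fun i _ => hg0 i) ?_)
    exact Finset.sum_nonneg fun i _ => mul_nonneg (hg0 i) (sq_nonneg _)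
  have hs := hsum.mul_left (∑' i, g i)
  have hsm := Summable.of_nonneg_of_le (fun k => sq_nonneg _) hle hs.summable
  refine ⟨hsm, (hsm.tsum_le_tsum hle hs.summable).trans (le_of_eq ?_)⟩
  rw [hs.tsum_eq]
  ring

/-- **Minkowski's inequality** for square-summable sequences. -/
theorem sqrt_tsum_norm_add_sq_le {F : Type*} [NormedAddCommGroup F] {a b : ℕ → F}
    (ha : Summable fun k => ‖a k‖ ^ 2) (hb : Summable fun k => ‖b k‖ ^ 2) :
    √(∑' k, ‖a k + b k‖ ^ 2) ≤ √(∑' k, ‖a k‖ ^ 2) + √(∑' k, ‖b k‖ ^ 2) := by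
  have hmem {c : ℕ → F} (hc : Summable fun k => ‖c k‖ ^ 2) : Memℓp c 2 :=
    (memℓp_gen_iff (by norm_num)).2 (by simpa using hc)
  have hnorm (c : lp (fun _ : ℕ => F) 2) : ‖c‖ = √(∑' k, ‖c k‖ ^ 2) := by
    rw [lp.norm_eq_tsum_rpow (by norm_num), Real.sqrt_eq_rpow]
    simp
  have h := norm_add_le (⟨a, hmem ha⟩ : lp (fun _ : ℕ => F) 2) ⟨b, hmem hb⟩
  rw [hnorm, hnorm, hnorm] at h
  exact h

/-- **Parseval's identity** for a vector-valued polynomial sampled at the roots of unity. -/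
theorem sum_norm_sq_sum_pow_smul {F : Type*} [NormedAddCommGroup F] [InnerProductSpace ℂ F]
    {L : ℕ} {ζ : ℂ} (hL : L ≠ 0) (hζ : IsPrimitiveRoot ζ L) (y : ℕ → F) :
    ∑ m ∈ Finset.range L, ‖∑ k ∈ Finset.range L, (ζ ^ m) ^ k • y k‖ ^ 2 =
      L * ∑ k ∈ Finset.range L, ‖y k‖ ^ 2 := by
  have hnorm : ‖ζ‖ = 1 := hζ.norm'_eq_one hL
  have hζ0 : ζ ≠ 0 := hζ.ne_zero hL
  have horth : ∀ j ∈ Finset.range L, ∀ k ∈ Finset.range L,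
      ∑ m ∈ Finset.range L, (starRingEnd ℂ ((ζ ^ m) ^ j)) * (ζ ^ m) ^ k =
        if j = k then (L : ℂ) else 0 := by
    intro j hj k hk
    have hη : ∀ m, (starRingEnd ℂ ((ζ ^ m) ^ j)) * (ζ ^ m) ^ k = ((ζ ^ j)⁻¹ * ζ ^ k) ^ m := by
      intro m
      rw [map_pow, map_pow, ← Complex.inv_eq_conj hnorm]
      simp only [mul_pow, inv_pow, ← pow_mul]
      simp only [mul_comm]
    simp only [hη]
    split_ifs with hjk
    · subst hjk
      simp [hζ0]
    · have hne : (ζ ^ j)⁻¹ * ζ ^ k ≠ 1 := by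
        intro h
        refine hjk (hζ.pow_inj (Finset.mem_range.1 hj) (Finset.mem_range.1 hk) ?_)
        field_simp at h
        exact h.symm
      have hpow : ((ζ ^ j)⁻¹ * ζ ^ k) ^ L = 1 := by
        rw [mul_pow, inv_pow, ← pow_mul, ← pow_mul, mul_comm j, mul_comm k, pow_mul, pow_mul,
          hζ.pow_eq_one]
        simp
      rw [geom_sum_eq hne, hpow, sub_self, zero_div]
  have hcomplex : ((∑ m ∈ Finset.range L, ‖∑ k ∈ Finset.range L, (ζ ^ m) ^ k • y k‖ ^ 2 : ℝ) : ℂ) =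
      ((L * ∑ k ∈ Finset.range L, ‖y k‖ ^ 2 : ℝ) : ℂ) := by
    push_cast
    have hexp : ∀ m, ((‖∑ k ∈ Finset.range L, (ζ ^ m) ^ k • y k‖ : ℂ)) ^ 2 =
        ∑ j ∈ Finset.range L, ∑ k ∈ Finset.range L,
          (starRingEnd ℂ ((ζ ^ m) ^ j)) * (ζ ^ m) ^ k * inner ℂ (y j) (y k) := by
      intro m
      have h : inner ℂ (∑ k ∈ Finset.range L, (ζ ^ m) ^ k • y k)
          (∑ k ∈ Finset.range L, (ζ ^ m) ^ k • y k) =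
          (‖∑ k ∈ Finset.range L, (ζ ^ m) ^ k • y k‖ : ℂ) ^ 2 := inner_self_eq_norm_sq_to_K _
      rw [sum_inner] at h
      simp only [inner_sum, inner_smul_left, inner_smul_right] at h
      rw [← h]
      exact Finset.sum_congr rfl fun j _ => Finset.sum_congr rfl fun k _ => by ring
    simp only [hexp]
    rw [Finset.sum_comm, Finset.mul_sum]
    refine Finset.sum_congr rfl fun j hj => ?_
    rw [Finset.sum_comm]
    simp only [← Finset.sum_mul]
    rw [Finset.sum_congr rfl fun k hk => by rw [horth j hj k hk]]
    simp [Finset.mem_range.1 hj]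
  exact_mod_cast hcomplex

/-- The convolution of a summable sequence of operators with a square-summable sequence of vectors
is square-summable, with the bound of Young's inequality. -/
theorem summable_and_tsum_norm_sq_conv_le {E F : Type*} [NormedAddCommGroup E] [NormedSpace ℂ E]
    [NormedAddCommGroup F] [NormedSpace ℂ F] {g : ℕ → E →L[ℂ] F} (hg : Summable fun i => ‖g i‖)
    {u : ℕ → E} (hu : Summable fun k => ‖u k‖ ^ 2) :
    Summable (fun k => ‖∑ i ∈ Finset.range (k + 1), g i (u (k - i))‖ ^ 2) ∧
      ∑' k, ‖∑ i ∈ Finset.range (k + 1), g i (u (k - i))‖ ^ 2 ≤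
        (∑' i, ‖g i‖) ^ 2 * ∑' k, ‖u k‖ ^ 2 := by
  obtain ⟨hs, hle⟩ := summable_and_tsum_sq_sum_range_mul_le (fun i => norm_nonneg (g i)) hg hu
  have hk : ∀ k, ‖∑ i ∈ Finset.range (k + 1), g i (u (k - i))‖ ^ 2 ≤
      (∑ i ∈ Finset.range (k + 1), ‖g i‖ * ‖u (k - i)‖) ^ 2 := fun k =>
    pow_le_pow_left₀ (norm_nonneg _) (norm_sum_le_of_le _ fun i _ => (g i).le_opNorm _) 2
  have hs' := Summable.of_nonneg_of_le (fun k => sq_nonneg _) hk hs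
  exact ⟨hs', (hs'.tsum_le_tsum hk hs).trans hle⟩

/-- The generating function of a convolution is the transfer function applied to the generating
function of the input. -/
theorem hasSum_pow_smul_conv {E F : Type*} [NormedAddCommGroup E] [NormedSpace ℂ E]
    [NormedAddCommGroup F] [NormedSpace ℂ F] [CompleteSpace F] {g : ℕ → E →L[ℂ] F}
    (hg : Summable fun i => ‖g i‖) {u : ℕ → E} (hu : Summable fun k => ‖u k‖)
    {w : ℂ} (hw : ‖w‖ ≤ 1) {U : E} (hU : HasSum (fun k => w ^ k • u k) U) {V : F}
    (hV : HasSum (fun i => w ^ i • g i U) V) :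
    HasSum (fun k => w ^ k • ∑ i ∈ Finset.range (k + 1), g i (u (k - i))) V := by
  have hprod : Summable fun x : ℕ × ℕ => w ^ x.1 • g x.1 (w ^ x.2 • u x.2) := by
    refine Summable.of_norm_bounded
      (hg.mul_of_nonneg hu (fun _ => norm_nonneg _) fun _ => norm_nonneg _) fun x => ?_
    have h1 : ‖w ^ x.1‖ ≤ 1 := by rw [norm_pow]; exact pow_le_one₀ (norm_nonneg _) hw
    have h2 : ‖w ^ x.2‖ ≤ 1 := by rw [norm_pow]; exact pow_le_one₀ (norm_nonneg _) hw
    rw [map_smul, norm_smul, norm_smul]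
    calc ‖w ^ x.1‖ * (‖w ^ x.2‖ * ‖g x.1 (u x.2)‖) ≤ 1 * (1 * ‖g x.1 (u x.2)‖) := by gcongr
      _ ≤ ‖g x.1‖ * ‖u x.2‖ := by simpa using (g x.1).le_opNorm _
  have hinner := hprod.hasSum.prod_fiberwise fun i => ((g i).hasSum hU).const_smul (w ^ i)
  have hsum := hprod.hasSum
  rw [hinner.unique hV, ← Finset.HasAntidiagonal.sigmaAntidiagonalEquivProd.hasSum_iff] at hsum
  convert! hsum.sigma fun k => hasSum_fintype _ using 2 with k
  rw [← Finset.Nat.sum_antidiagonal_eq_sum_range_succ (fun i j => g i (u j)),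
    Finset.smul_sum, ← Finset.sum_finset_coe]
  refine Finset.sum_congr rfl fun x _ => ?_
  have hx : x.1.1 + x.1.2 = k := Finset.HasAntidiagonal.mem_antidiagonal.1 x.2
  simp [smul_smul, ← pow_add, hx]

open Filter Topology in
/-- The lower bound of `mul_tsum_norm_sq_le_tsum_norm_sq_conv` for finitely supported inputs. -/
theorem mul_sum_norm_sq_le_tsum_norm_sq_conv_of_support {E F : Type*} [NormedAddCommGroup E]
    [InnerProductSpace ℂ E] [NormedAddCommGroup F] [InnerProductSpace ℂ F] [CompleteSpace F]
    {g : ℕ → E →L[ℂ] F} (hg : Summable fun i => ‖g i‖) {s : ℝ}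
    (hs : ∀ w : ℂ, ‖w‖ = 1 → ∀ v : E, ∃ V : F,
      HasSum (fun i => w ^ i • g i v) V ∧ s * ‖v‖ ^ 2 ≤ ‖V‖ ^ 2)
    {u : ℕ → E} {K : ℕ} (hu : ∀ k, K ≤ k → u k = 0) :
    s * ∑ k ∈ Finset.range K, ‖u k‖ ^ 2 ≤
      ∑' k, ‖∑ i ∈ Finset.range (k + 1), g i (u (k - i))‖ ^ 2 := by
  have huK : ∀ k ∉ Finset.range K, u k = 0 := fun k hk => hu k (by simpa using hk)
  have hu1 : Summable fun k => ‖u k‖ :=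
    summable_of_ne_finset_zero (s := Finset.range K) fun k hk => by simp [huK k hk]
  have hu2 : Summable fun k => ‖u k‖ ^ 2 :=
    summable_of_ne_finset_zero (s := Finset.range K) fun k hk => by simp [huK k hk]
  set y : ℕ → F := fun k => ∑ i ∈ Finset.range (k + 1), g i (u (k - i)) with hy
  have hy2 : Summable fun k => ‖y k‖ ^ 2 := (summable_and_tsum_norm_sq_conv_le hg hu2).1
  have hy1 : Summable fun k => ‖y k‖ := by
    refine Summable.of_nonneg_of_le (fun k => norm_nonneg _)
      (fun k => norm_sum_le_of_le _ fun i _ => (g i).le_opNorm _)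
      (hasSum_sum_range_mul_of_summable_norm (f := fun i => ‖g i‖) (g := fun k => ‖u k‖)
        hg.norm hu1.norm).summable
  set c := ∑' k, ‖y k‖
  set δ : ℕ → ℝ := fun L => ∑' k, ‖y (k + L)‖
  have hδ : Tendsto δ atTop (𝓝 0) := tendsto_sum_nat_add fun k => ‖y k‖
  have hδc : ∀ L, (∑ k ∈ Finset.range L, ‖y k‖) + δ L = c := fun L => hy1.sum_add_tsum_nat_add L
  have hδ0 : ∀ L, 0 ≤ δ L := fun L => tsum_nonneg fun _ => norm_nonneg _
  have hpoint : ∀ w : ℂ, ‖w‖ = 1 → ∀ L, K ≤ L →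
      s * ‖∑ k ∈ Finset.range L, w ^ k • u k‖ ^ 2 ≤
        ‖∑ k ∈ Finset.range L, w ^ k • y k‖ ^ 2 + 3 * c * δ L := by
    intro w hw L hL
    have hU : HasSum (fun k => w ^ k • u k) (∑ k ∈ Finset.range L, w ^ k • u k) :=
      hasSum_sum_of_ne_finset_zero fun k hk => by
        rw [hu k (hL.trans (by simpa using hk)), smul_zero]
    obtain ⟨V, hV, hsV⟩ := hs w hw (∑ k ∈ Finset.range L, w ^ k • u k)
    have hYV := hasSum_pow_smul_conv hg hu1 hw.le hU hV
    have hnorm : ∀ k, ‖w ^ k • y k‖ = ‖y k‖ := fun k => by simp [norm_smul, hw]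
    have htail : ‖V - ∑ k ∈ Finset.range L, w ^ k • y k‖ ≤ δ L := by
      have h := (hasSum_nat_add_iff' L).2 hYV
      have hle := norm_tsum_le_tsum_norm (f := fun k => w ^ (k + L) • y (k + L))
        (by simpa only [hnorm] using (summable_nat_add_iff L).2 hy1)
      rw [h.tsum_eq] at hle
      simpa only [hnorm] using hle
    have hYL : ‖∑ k ∈ Finset.range L, w ^ k • y k‖ ≤ ∑ k ∈ Finset.range L, ‖y k‖ :=
      norm_sum_le_of_le _ fun k _ => (hnorm k).le
    have hVle : ‖V‖ ≤ ‖∑ k ∈ Finset.range L, w ^ k • y k‖ + δ L := by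
      have := norm_add_le (∑ k ∈ Finset.range L, w ^ k • y k)
        (V - ∑ k ∈ Finset.range L, w ^ k • y k)
      rw [add_sub_cancel] at this
      linarith
    have hsq := pow_le_pow_left₀ (norm_nonneg V) hVle 2
    have hsum0 : 0 ≤ ∑ k ∈ Finset.range L, ‖y k‖ := Finset.sum_nonneg fun _ _ => norm_nonneg _
    have hYc : ‖∑ k ∈ Finset.range L, w ^ k • y k‖ ≤ c := by linarith [hδc L, hδ0 L]
    have hδlec : δ L ≤ c := by linarith [hδc L]
    nlinarith [mul_le_mul_of_nonneg_right hYc (hδ0 L), mul_le_mul_of_nonneg_right hδlec (hδ0 L)]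
  have hlim : Tendsto (fun L => ∑' k, ‖y k‖ ^ 2 + 3 * c * δ L) atTop
      (𝓝 (∑' k, ‖y k‖ ^ 2 + 3 * c * 0)) := (hδ.const_mul _).const_add _
  rw [mul_zero, add_zero] at hlim
  refine ge_of_tendsto hlim ?_
  filter_upwards [eventually_ge_atTop K, eventually_gt_atTop 0] with L hL hL0
  have hζ := Complex.isPrimitiveRoot_exp L hL0.ne'
  set ζ := Complex.exp (2 * Real.pi * Complex.I / L)
  have hsum := Finset.sum_le_sum fun m (_ : m ∈ Finset.range L) =>
    hpoint (ζ ^ m) (by rw [norm_pow, hζ.norm'_eq_one hL0.ne', one_pow]) L hL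
  rw [← Finset.mul_sum, Finset.sum_add_distrib, sum_norm_sq_sum_pow_smul hL0.ne' hζ,
    sum_norm_sq_sum_pow_smul hL0.ne' hζ, Finset.sum_const, Finset.card_range, nsmul_eq_mul] at hsum
  have huL : ∑ k ∈ Finset.range K, ‖u k‖ ^ 2 = ∑ k ∈ Finset.range L, ‖u k‖ ^ 2 :=
    Finset.sum_subset (Finset.range_mono hL) fun k _ hk => by simp [huK k hk]
  have hyL : ∑ k ∈ Finset.range L, ‖y k‖ ^ 2 ≤ ∑' k, ‖y k‖ ^ 2 :=
    hy2.sum_le_tsum _ fun _ _ => sq_nonneg _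
  have hLpos : (0 : ℝ) < L := by exact_mod_cast hL0
  have : s * ∑ k ∈ Finset.range L, ‖u k‖ ^ 2 ≤
      ∑ k ∈ Finset.range L, ‖y k‖ ^ 2 + 3 * c * δ L := by
    refine le_of_mul_le_mul_left ?_ hLpos
    linarith
  rw [huL]
  linarith

open Filter Topology in
/-- If the transfer function of a summable sequence of operators is bounded below on the unit
circle, then so is convolution with that sequence on square-summable inputs. -/
theorem mul_tsum_norm_sq_le_tsum_norm_sq_conv {E F : Type*} [NormedAddCommGroup E]
    [InnerProductSpace ℂ E] [NormedAddCommGroup F] [InnerProductSpace ℂ F] [CompleteSpace F]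
    {g : ℕ → E →L[ℂ] F} (hg : Summable fun i => ‖g i‖) {s : ℝ}
    (hs : ∀ w : ℂ, ‖w‖ = 1 → ∀ v : E, ∃ V : F,
      HasSum (fun i => w ^ i • g i v) V ∧ s * ‖v‖ ^ 2 ≤ ‖V‖ ^ 2)
    {u : ℕ → E} (hu : Summable fun k => ‖u k‖ ^ 2) :
    s * ∑' k, ‖u k‖ ^ 2 ≤ ∑' k, ‖∑ i ∈ Finset.range (k + 1), g i (u (k - i))‖ ^ 2 := by
  set c := ∑' i, ‖g i‖
  have hc : 0 ≤ c := tsum_nonneg fun _ => norm_nonneg _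
  set S := ∑' k, ‖u k‖ ^ 2 with hS
  set T := ∑' k, ‖∑ i ∈ Finset.range (k + 1), g i (u (k - i))‖ ^ 2
  have hT : 0 ≤ T := tsum_nonneg fun _ => sq_nonneg _
  have hbound : ∀ K, √(s * ∑ k ∈ Finset.range K, ‖u k‖ ^ 2) ≤
      √T + c * √(∑' k, ‖u (k + K)‖ ^ 2) := by
    intro K
    set a : ℕ → E := fun k => if k < K then u k else 0 with ha
    set b : ℕ → E := fun k => if k < K then 0 else -u k with hb
    have hb2 : Summable fun k => ‖b k‖ ^ 2 := by
      refine Summable.of_nonneg_of_le (fun k => sq_nonneg _) (fun k => ?_) hu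
      by_cases hk : k < K <;> simp [hb, hk]
    have hbsum : ∑' k, ‖b k‖ ^ 2 = ∑' k, ‖u (k + K)‖ ^ 2 := by
      rw [← hb2.sum_add_tsum_nat_add K, Finset.sum_eq_zero fun k hk => by
        simp [hb, Finset.mem_range.1 hk], zero_add]
      simp [hb]
    have hab : ∀ k, a k = u k + b k := fun k => by by_cases hk : k < K <;> simp [ha, hb, hk]
    have hmain := mul_sum_norm_sq_le_tsum_norm_sq_conv_of_support hg hs (u := a) (K := K)
      fun k hk => by simp [ha, hk.not_gt]
    have hasum : ∑ k ∈ Finset.range K, ‖a k‖ ^ 2 = ∑ k ∈ Finset.range K, ‖u k‖ ^ 2 :=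
      Finset.sum_congr rfl fun k hk => by simp [ha, Finset.mem_range.1 hk]
    rw [hasum] at hmain
    have hadd := sqrt_tsum_norm_add_sq_le (summable_and_tsum_norm_sq_conv_le hg hu).1
      (summable_and_tsum_norm_sq_conv_le hg hb2).1
    simp only [← Finset.sum_add_distrib, ← map_add, ← hab] at hadd
    refine (Real.sqrt_le_sqrt hmain).trans (hadd.trans (add_le_add_right ?_ _))
    have hby := Real.sqrt_le_sqrt (summable_and_tsum_norm_sq_conv_le hg hb2).2
    rwa [Real.sqrt_mul (sq_nonneg _), Real.sqrt_sq hc, hbsum] at hby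
  have hl : Tendsto (fun K => √(s * ∑ k ∈ Finset.range K, ‖u k‖ ^ 2)) atTop (𝓝 √(s * S)) :=
    (hu.hasSum.tendsto_sum_nat.const_mul s).sqrt
  have hr : Tendsto (fun K => √T + c * √(∑' k, ‖u (k + K)‖ ^ 2)) atTop (𝓝 (√T + c * √0)) :=
    (((tendsto_sum_nat_add fun k => ‖u k‖ ^ 2).sqrt).const_mul c).const_add _
  have h := le_of_tendsto_of_tendsto' hl hr hbound
  rw [Real.sqrt_zero, mul_zero, add_zero] at h
  exact (Real.sqrt_le_sqrt_iff hT).1 h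

/-- The complexification of a real vector. -/
noncomputable def complexify {m : Type*} (v : EuclideanSpace ℝ m) : EuclideanSpace ℂ m :=
  WithLp.toLp 2 fun i => (v i : ℂ)

theorem norm_complexify {m : Type*} [Fintype m] (v : EuclideanSpace ℝ m) :
    ‖complexify v‖ = ‖v‖ := by
  simp [complexify, EuclideanSpace.norm_eq]

theorem complexify_sum {m ι : Type*} (s : Finset ι) (v : ι → EuclideanSpace ℝ m) :
    complexify (∑ i ∈ s, v i) = ∑ i ∈ s, complexify (v i) := by
  ext j
  simp [complexify]

theorem toEuclideanLin_map_complexify {m n : Type*} [Fintype m] [Fintype n] [DecidableEq n]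
    (M : Matrix m n ℝ) (v : EuclideanSpace ℝ n) :
    Matrix.toEuclideanLin (M.map Complex.ofReal) (complexify v) =
      complexify (Matrix.toEuclideanLin M v) := by
  ext j
  simp [complexify, Matrix.toLpLin_apply, Matrix.mulVec, dotProduct]

theorem opNorm_le_opNorm_map {m n : Type*} [Fintype m] [Fintype n] [DecidableEq n]
    (M : Matrix m n ℝ) : opNorm M ≤ opNorm (M.map Complex.ofReal) := by
  refine ContinuousLinearMap.opNorm_le_bound _ (norm_nonneg _) fun v => ?_
  rw [← norm_complexify v, LinearMap.coe_toContinuousLinearMap', ← norm_complexify,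
    ← toEuclideanLin_map_complexify]
  exact (LinearMap.toContinuousLinearMap
    (Matrix.toEuclideanLin (M.map Complex.ofReal))).le_opNorm _

theorem sigmaMin_nonneg {m n : Type*} [Fintype m] [Fintype n] [DecidableEq n]
    (M : Matrix m n ℂ) : 0 ≤ sigmaMin M :=
  Real.iInf_nonneg fun _ => norm_nonneg _

theorem sigmaMin_mul_norm_le {m n : Type*} [Fintype m] [Fintype n] [DecidableEq n]
    (M : Matrix m n ℂ) (v : EuclideanSpace ℂ n) :
    sigmaMin M * ‖v‖ ≤ ‖Matrix.toEuclideanLin M v‖ := by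
  rcases eq_or_ne v 0 with rfl | hv
  · simp
  have hv' : 0 < ‖v‖ := norm_pos_iff.2 hv
  have h : sigmaMin M ≤ ‖Matrix.toEuclideanLin M ((‖v‖⁻¹ : ℂ) • v)‖ :=
    ciInf_le (f := fun v : {v : EuclideanSpace ℂ n // ‖v‖ = 1} => ‖Matrix.toEuclideanLin M v.1‖)
      ⟨0, by rintro _ ⟨_, rfl⟩; exact norm_nonneg _⟩
      ⟨(‖v‖⁻¹ : ℂ) • v, by simp [norm_smul, hv'.ne']⟩
  rw [map_smul, norm_smul, norm_inv, Complex.norm_real, norm_norm] at h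
  calc sigmaMin M * ‖v‖ ≤ ‖v‖⁻¹ * ‖Matrix.toEuclideanLin M v‖ * ‖v‖ := by gcongr
    _ = ‖Matrix.toEuclideanLin M v‖ := by field_simp

/-- The impulse response of the discrete-time linear system `(A, B, C, D)`. -/
def impulseResponse {𝕜 m n l : Type*} [RCLike 𝕜] [Fintype n] [DecidableEq n] (A : Matrix n n 𝕜)
    (B : Matrix n l 𝕜) (C : Matrix m n 𝕜) (D : Matrix m l 𝕜) (i : ℕ) : Matrix m l 𝕜 :=
  if i = 0 then D else C * A ^ (i - 1) * B

theorem map_impulseResponse {m n l : Type*} [Fintype n] [DecidableEq n] (A : Matrix n n ℝ)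
    (B : Matrix n l ℝ) (C : Matrix m n ℝ) (D : Matrix m l ℝ) (i : ℕ) :
    (impulseResponse A B C D i).map Complex.ofReal =
      impulseResponse (A.map Complex.ofReal) (B.map Complex.ofReal) (C.map Complex.ofReal)
        (D.map Complex.ofReal) i := by
  unfold impulseResponse
  split_ifs
  · rfl
  · have hpow : (A ^ (i - 1)).map Complex.ofReal = A.map Complex.ofReal ^ (i - 1) :=
      Matrix.map_pow A Complex.ofRealHom (i - 1)
    rw [← hpow]
    change (C * A ^ (i - 1) * B).map Complex.ofRealHom = C.map Complex.ofRealHom *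
      (A ^ (i - 1)).map Complex.ofRealHom * B.map Complex.ofRealHom
    rw [Matrix.map_mul, Matrix.map_mul]

theorem summable_norm_linearMap {R V : Type*} [NormedAddCommGroup R] [NormedSpace ℂ R]
    [FiniteDimensional ℂ R] [NormedAddCommGroup V] [NormedSpace ℂ V] (φ : R →ₗ[ℂ] V) {x : ℕ → R}
    (hx : Summable fun i => ‖x i‖) : Summable fun i => ‖φ (x i)‖ :=
  Summable.of_nonneg_of_le (fun _ => norm_nonneg _)
    (fun i => (LinearMap.toContinuousLinearMap φ).le_opNorm (x i)) (hx.mul_left _)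

section Transfer

attribute [local instance] Matrix.linftyOpNormedRing Matrix.linftyOpNormedAlgebra

variable {m n l : Type*} [Fintype m] [Fintype n] [Fintype l] [DecidableEq n] [DecidableEq l]

theorem summable_opNorm_impulseResponse {A : Matrix n n ℂ} (hA : spectralRadius ℂ A < 1)
    (B : Matrix n l ℂ) (C : Matrix m n ℂ) (D : Matrix m l ℂ) :
    Summable fun i => opNorm (impulseResponse A B C D i) := by
  have hpow := summable_norm_pow_of_spectralRadius_lt_one A hA
  let φ : Matrix n n ℂ →ₗ[ℂ] (EuclideanSpace ℂ l →L[ℂ] EuclideanSpace ℂ m) :=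
    { toFun := fun M => LinearMap.toContinuousLinearMap (Matrix.toEuclideanLin (C * M * B))
      map_add' := fun M N => by simp [Matrix.mul_add, Matrix.add_mul]
      map_smul' := fun a M => by simp }
  rw [← summable_nat_add_iff 1]
  simpa [impulseResponse, φ, opNorm] using summable_norm_linearMap φ hpow

theorem hasSum_pow_smul_impulseResponse {A : Matrix n n ℂ} (hA : spectralRadius ℂ A < 1)
    (B : Matrix n l ℂ) (C : Matrix m n ℂ) (D : Matrix m l ℂ) {w : ℂ} (hw : ‖w‖ = 1)
    (v : EuclideanSpace ℂ l) :
    HasSum (fun i => w ^ i • Matrix.toEuclideanLin (impulseResponse A B C D i) v)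
      (Matrix.toEuclideanLin (D + C * (w⁻¹ • (1 : Matrix n n ℂ) - A)⁻¹ * B) v) := by
  have hw0 : w ≠ 0 := norm_ne_zero_iff.1 (by rw [hw]; exact one_ne_zero)
  have hpow : Summable fun i : ℕ => (w • A) ^ i := by
    refine Summable.of_norm ?_
    simpa [smul_pow, norm_smul, hw] using summable_norm_pow_of_spectralRadius_lt_one A hA
  have hinv : (w⁻¹ • (1 : Matrix n n ℂ) - A)⁻¹ = w • ∑' i : ℕ, (w • A) ^ i := by
    refine Matrix.inv_eq_right_inv ?_
    rw [mul_smul_comm, ← smul_mul_assoc, smul_sub, smul_inv_smul₀ hw0]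
    exact hpow.one_sub_mul_tsum_pow
  let ψ : Matrix n n ℂ →ₗ[ℂ] EuclideanSpace ℂ m :=
    { toFun := fun M => Matrix.toEuclideanLin (C * M * B) v
      map_add' := fun M N => by simp [Matrix.mul_add, Matrix.add_mul]
      map_smul' := fun a M => by simp }
  have hψ := (hpow.hasSum.const_smul w).mapL (LinearMap.toContinuousLinearMap ψ)
  rw [← hinv] at hψ
  rw [← hasSum_nat_add_iff' 1]
  convert! hψ using 1
  · ext1 i
    simp [impulseResponse, ψ, smul_pow, smul_smul, pow_succ']
  · simp [impulseResponse, ψ]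

end Transfer

/-- Let `A : n×n` real with `spectralRadius(A) < 1` (as a complex matrix),
`B : n×q`, `C : p×n`, `D : p×q` real. With `G^[0] = D` and `G^[i] = C·A^{i−1}·B` for
`i ≥ 1`, we have `Σ_{i≥0} ‖G^[i]‖_op < ∞`, and for every input sequence `u` of unit
ℓ² norm, `Σ_{n=0}^∞ ‖(G∗u)(n)‖₂²` converges with sum at least
`⨅_{z ∈ ℂ, |z|=1} σ_min(D + C·(z·I − A)^{−1}·B)²`. -/
theorem stmt7 {n p q : ℕ} (A : Matrix (Fin n) (Fin n) ℝ) (B : Matrix (Fin n) (Fin q) ℝ)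
    (C : Matrix (Fin p) (Fin n) ℝ) (D : Matrix (Fin p) (Fin q) ℝ)
    (hA : spectralRadius ℂ (A.map Complex.ofReal) < 1) :
    Summable (fun i : ℕ => opNorm (if i = 0 then D else C * A ^ (i - 1) * B)) ∧
      ∀ u : ℕ → EuclideanSpace ℝ (Fin q), HasSum (fun k => ‖u k‖ ^ 2) 1 →
        Summable (fun k : ℕ =>
            ‖conv (fun i => if i = 0 then D else C * A ^ (i - 1) * B) u k‖ ^ 2) ∧
          (⨅ z : {z : ℂ // ‖z‖ = 1},
              sigmaMin (D.map Complex.ofReal +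
                C.map Complex.ofReal *
                  (z.1 • (1 : Matrix (Fin n) (Fin n) ℂ) - A.map Complex.ofReal)⁻¹ *
                B.map Complex.ofReal) ^ 2) ≤
            ∑' k : ℕ, ‖conv (fun i => if i = 0 then D else C * A ^ (i - 1) * B) u k‖ ^ 2 := by
  change Summable (fun i => opNorm (impulseResponse A B C D i)) ∧ ∀ u : ℕ → EuclideanSpace ℝ (Fin q),
    HasSum (fun k => ‖u k‖ ^ 2) 1 →
      Summable (fun k => ‖conv (impulseResponse A B C D) u k‖ ^ 2) ∧
        _ ≤ ∑' k, ‖conv (impulseResponse A B C D) u k‖ ^ 2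
  have hsum := summable_opNorm_impulseResponse hA (B.map Complex.ofReal) (C.map Complex.ofReal)
    (D.map Complex.ofReal)
  refine ⟨Summable.of_nonneg_of_le (fun _ => norm_nonneg _) (fun i => ?_) hsum, fun u hu => ?_⟩
  · rw [← map_impulseResponse]
    exact opNorm_le_opNorm_map _
  set g : ℕ → EuclideanSpace ℂ (Fin q) →L[ℂ] EuclideanSpace ℂ (Fin p) := fun i =>
    LinearMap.toContinuousLinearMap (Matrix.toEuclideanLin (impulseResponse (A.map Complex.ofReal)
      (B.map Complex.ofReal) (C.map Complex.ofReal) (D.map Complex.ofReal) i)) with hg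
  have hconv : ∀ k, ‖conv (impulseResponse A B C D) u k‖ =
      ‖∑ i ∈ Finset.range (k + 1), g i (complexify (u (k - i)))‖ := fun k => by
    simp only [hg, LinearMap.coe_toContinuousLinearMap', ← map_impulseResponse,
      toEuclideanLin_map_complexify]
    rw [← complexify_sum, norm_complexify, conv]
  have hnorm : ∀ k, ‖complexify (u k)‖ = ‖u k‖ := fun k => norm_complexify _
  have hu2 : Summable fun k => ‖complexify (u k)‖ ^ 2 := by simpa only [hnorm] using hu.summable
  simp only [hconv]
  refine ⟨(summable_and_tsum_norm_sq_conv_le hsum hu2).1, ?_⟩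
  set s := ⨅ z : {z : ℂ // ‖z‖ = 1}, sigmaMin (D.map Complex.ofReal +
    C.map Complex.ofReal * (z.1 • (1 : Matrix (Fin n) (Fin n) ℂ) - A.map Complex.ofReal)⁻¹ *
      B.map Complex.ofReal) ^ 2
  have hs : ∀ w : ℂ, ‖w‖ = 1 → ∀ v : EuclideanSpace ℂ (Fin q), ∃ V,
      HasSum (fun i => w ^ i • g i v) V ∧ s * ‖v‖ ^ 2 ≤ ‖V‖ ^ 2 := by
    intro w hw v
    refine ⟨_, hasSum_pow_smul_impulseResponse hA _ _ _ hw v, le_trans ?_ (pow_le_pow_left₀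
      (mul_nonneg (sigmaMin_nonneg _) (norm_nonneg _)) (sigmaMin_mul_norm_le _ v) 2)⟩
    rw [mul_pow]
    refine mul_le_mul_of_nonneg_right (ciInf_le ⟨0, ?_⟩ (⟨w⁻¹, ?_⟩ : {z : ℂ // ‖z‖ = 1}))
      (sq_nonneg _)
    · rintro _ ⟨_, rfl⟩
      exact sq_nonneg _
    · rw [norm_inv, hw, inv_one]
  simpa only [hnorm, hu.tsum_eq, mul_one] using mul_tsum_norm_sq_le_tsum_norm_sq_conv hsum hs hu2
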